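/- arXiv:2312.13970 — 9 statements merged into one kernel-verified Lean document; each statement's English description precedes it below -/
import Mathlib

section
/- Let n ≥ 1, let r, c ∈ ℝ^n have nonnegative entries, and let 0 ≤ s ≤ min{‖r‖₁, ‖c‖₁}. Let X ∈ ℝ^{n×n} and p, q ∈ ℝ^n have nonnegative entries, and let δ ≥ 0 satisfy ‖X𝟙 + p − r‖₁ + ‖Xᵀ𝟙 + q − c‖₁ + |Σ_{i,j} X_{ij} − s| ≤ δ. Then there exist a matrix X̄ ∈ ℝ^{n×n} and vectors p̄, q̄ ∈ ℝ^n, all with nonnegative entries, such that X̄𝟙 + p̄ = r, X̄ᵀ𝟙 + q̄ = c, Σ_{i,j} X̄_{ij} = s, and Σ_{i,j} |X_{ij} − X̄_{ij}| + ‖p − p̄‖₁ + ‖q − q̄‖₁ ≤ 23δ. -/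
open Finset in
/-- A nonnegative vector can be shrunk entrywise to any smaller nonnegative total mass. -/
theorem exists_le_sum_eq_min {ι : Type*} [Fintype ι] (x : ι → ℝ) (hx : ∀ i, 0 ≤ x i)
    (t : ℝ) (ht : 0 ≤ t) :
    ∃ y : ι → ℝ, (∀ i, 0 ≤ y i) ∧ (∀ i, y i ≤ x i) ∧ ∑ i, y i = min (∑ i, x i) t := by
  rcases le_or_gt (∑ i, x i) t with h | h
  · exact ⟨x, hx, fun _ => le_rfl, (min_eq_left h).symm⟩
  · have hpos : 0 < ∑ i, x i := ht.trans_lt h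
    refine ⟨fun i => t / (∑ i, x i) * x i, fun i => mul_nonneg (by positivity) (hx i),
      fun i => mul_le_of_le_one_left (hx i) ((div_le_one hpos).2 h.le), ?_⟩
    rw [← mul_sum, div_mul_cancel₀ _ hpos.ne', min_eq_right h.le]

open Finset in
/-- A nonnegative matrix can be shrunk entrywise so that its row sums are at most `r`, removing
no more than the excess over `r + p`. -/
theorem exists_le_row_sum_le {ι κ : Type*} [Fintype ι] [Fintype κ] (X : ι → κ → ℝ)
    (hX : ∀ i j, 0 ≤ X i j) (r p : ι → ℝ) (hr : ∀ i, 0 ≤ r i) (hp : ∀ i, 0 ≤ p i) :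
    ∃ Y : ι → κ → ℝ, (∀ i j, 0 ≤ Y i j) ∧ (∀ i j, Y i j ≤ X i j) ∧ (∀ i, ∑ j, Y i j ≤ r i) ∧
      ∑ i, ∑ j, X i j - ∑ i, ∑ j, Y i j ≤ ∑ i, |(∑ j, X i j) + p i - r i| := by
  choose Y hY0 hYX hY using fun i => exists_le_sum_eq_min (X i) (hX i) (r i) (hr i)
  refine ⟨Y, hY0, hYX, fun i => (hY i).trans_le (min_le_right _ _), ?_⟩
  rw [← sum_sub_distrib]
  refine sum_le_sum fun i _ => ?_
  rw [hY i]
  rcases min_cases (∑ j, X i j) (r i) with h | h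
  · rw [h.1, sub_self]
    exact abs_nonneg _
  · linarith [le_abs_self ((∑ j, X i j) + p i - r i), hp i]

open Finset in
/-- A nonnegative matrix with row sums at most `r` and column sums at most `c` can be changed to
have total mass `s`, staying within these bounds, at cost equal to the change of mass. -/
theorem exists_sum_eq_of_row_col_le {ι κ : Type*} [Fintype ι] [Fintype κ] (Z : ι → κ → ℝ)
    (hZ : ∀ i j, 0 ≤ Z i j) (r : ι → ℝ) (c : κ → ℝ) (hr : ∀ i, ∑ j, Z i j ≤ r i)
    (hc : ∀ j, ∑ i, Z i j ≤ c j) (s : ℝ) (hs : 0 ≤ s) (hsr : s ≤ ∑ i, r i)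
    (hsc : s ≤ ∑ j, c j) :
    ∃ W : ι → κ → ℝ, (∀ i j, 0 ≤ W i j) ∧ (∀ i, ∑ j, W i j ≤ r i) ∧ (∀ j, ∑ i, W i j ≤ c j) ∧
      ∑ i, ∑ j, W i j = s ∧ ∑ i, ∑ j, |Z i j - W i j| = |∑ i, ∑ j, Z i j - s| := by
  rcases le_or_gt s (∑ i, ∑ j, Z i j) with h | h
  · obtain ⟨y, hy0, hyZ, hy⟩ := exists_le_sum_eq_min (fun a : ι × κ => Z a.1 a.2)
      (fun a => hZ a.1 a.2) s hs
    rw [Fintype.sum_prod_type, Fintype.sum_prod_type, min_eq_right h] at hy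
    refine ⟨fun i j => y (i, j), fun i j => hy0 _,
      fun i => (sum_le_sum fun j _ => hyZ (i, j)).trans (hr i),
      fun j => (sum_le_sum fun i _ => hyZ (i, j)).trans (hc j), hy, ?_⟩
    rw [abs_of_nonneg (sub_nonneg.2 h)]
    simp_rw [fun i j => abs_of_nonneg (sub_nonneg.2 (hyZ (i, j))), sum_sub_distrib]
    rw [hy]
  · set S := ∑ i, ∑ j, Z i j with hS
    set u : ι → ℝ := fun i => r i - ∑ j, Z i j with hu
    set v : κ → ℝ := fun j => c j - ∑ i, Z i j with hv
    have hu0 : ∀ i, 0 ≤ u i := fun i => sub_nonneg.2 (hr i)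
    have hv0 : ∀ j, 0 ≤ v j := fun j => sub_nonneg.2 (hc j)
    have hus : s - S ≤ ∑ i, u i := by
      simp only [hu, sum_sub_distrib]
      linarith
    have hvs : s - S ≤ ∑ j, v j := by
      simp only [hv, sum_sub_distrib]
      rw [sum_comm (f := fun j i => Z i j)]
      linarith
    have hd : 0 < s - S := sub_pos.2 h
    have hU : 0 < ∑ i, u i := hd.trans_le hus
    have hV : 0 < ∑ j, v j := hd.trans_le hvs
    set k := (s - S) / ((∑ i, u i) * ∑ j, v j) with hk
    have hk0 : 0 ≤ k := by positivity
    have hA0 : ∀ i j, 0 ≤ k * u i * v j := fun i j =>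
      mul_nonneg (mul_nonneg hk0 (hu0 i)) (hv0 j)
    have hkV : k * ∑ j, v j ≤ 1 := by
      rw [hk, div_mul_eq_mul_div, mul_div_mul_right _ _ hV.ne']
      exact (div_le_one hU).2 hus
    have hkU : k * ∑ i, u i ≤ 1 := by
      rw [hk, mul_comm (∑ i, u i), div_mul_eq_mul_div, mul_div_mul_right _ _ hU.ne']
      exact (div_le_one hV).2 hvs
    have hA : ∑ i, ∑ j, k * u i * v j = s - S := by
      simp_rw [← mul_sum, ← sum_mul, ← mul_sum]
      rw [hk, mul_assoc]
      exact div_mul_cancel₀ _ (mul_pos hU hV).ne'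
    refine ⟨fun i j => Z i j + k * u i * v j, fun i j => add_nonneg (hZ i j) (hA0 i j),
      fun i => ?_, fun j => ?_, ?_, ?_⟩
    · rw [sum_add_distrib, ← mul_sum]
      have := mul_le_of_le_one_left (hu0 i) hkV
      have : u i = r i - ∑ j, Z i j := rfl
      linarith
    · rw [sum_add_distrib, ← sum_mul, ← mul_sum]
      have := mul_le_of_le_one_left (hv0 j) hkU
      have : v j = c j - ∑ i, Z i j := rfl
      linarith
    · simp_rw [sum_add_distrib]
      rw [hA]
      linarith
    · simp_rw [sub_add_cancel_left, abs_neg, fun i j => abs_of_nonneg (hA0 i j)]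
      rw [hA, abs_sub_comm, abs_of_pos hd]

open Finset in
/-- Replacing the slack `p` of `X` by the exact slack of `W` costs at most the row-sum error of
`X` plus the distance from `X` to `W`. -/
theorem sum_abs_slack_sub_le {ι κ : Type*} [Fintype ι] [Fintype κ] (X W : ι → κ → ℝ)
    (r p : ι → ℝ) :
    ∑ i, |p i - (r i - ∑ j, W i j)| ≤
      ∑ i, |(∑ j, X i j) + p i - r i| + ∑ i, ∑ j, |X i j - W i j| := by
  rw [← sum_add_distrib]
  refine sum_le_sum fun i _ => ?_
  have h : p i - (r i - ∑ j, W i j) =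
      ((∑ j, X i j) + p i - r i) - ∑ j, (X i j - W i j) := by
    rw [sum_sub_distrib]
    ring
  rw [h]
  exact (abs_sub _ _).trans (add_le_add_right (abs_sum_le_sum_abs _ _) _)

/-- Guarantee of the Round-POT algorithm: any approximately feasible point of the
POT polytope (with slack variables p, q) can be rounded to an exactly feasible
point at ℓ1 distance at most 23δ. -/
theorem stmt_0 (n : ℕ) (hn : 1 ≤ n)
    (r c : Fin n → ℝ) (hr : ∀ i, 0 ≤ r i) (hc : ∀ j, 0 ≤ c j)
    (s : ℝ) (hs0 : 0 ≤ s) (hs : s ≤ min (∑ i, |r i|) (∑ j, |c j|))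
    (X : Matrix (Fin n) (Fin n) ℝ) (p q : Fin n → ℝ)
    (hX : ∀ i j, 0 ≤ X i j) (hp : ∀ i, 0 ≤ p i) (hq : ∀ j, 0 ≤ q j)
    (δ : ℝ) (hδ : 0 ≤ δ)
    (happrox : (∑ i, |(∑ j, X i j) + p i - r i|)
      + (∑ j, |(∑ i, X i j) + q j - c j|)
      + |(∑ i, ∑ j, X i j) - s| ≤ δ) :
    ∃ (Xb : Matrix (Fin n) (Fin n) ℝ) (pb qb : Fin n → ℝ),
      (∀ i j, 0 ≤ Xb i j) ∧ (∀ i, 0 ≤ pb i) ∧ (∀ j, 0 ≤ qb j) ∧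
      (∀ i, (∑ j, Xb i j) + pb i = r i) ∧
      (∀ j, (∑ i, Xb i j) + qb j = c j) ∧
      (∑ i, ∑ j, Xb i j) = s ∧
      (∑ i, ∑ j, |X i j - Xb i j|) + (∑ i, |p i - pb i|) + (∑ j, |q j - qb j|)
        ≤ 23 * δ := by
  obtain ⟨Y, hY0, hYX, hYr, hYd⟩ := exists_le_row_sum_le X hX r p hr hp
  have hYXc : ∀ j, ∑ i, Y i j ≤ ∑ i, X i j := fun j => Finset.sum_le_sum fun i _ => hYX i j
  obtain ⟨Z, hZ0, hZY, hZc, hZd⟩ := exists_le_row_sum_le (fun j i => Y i j) (fun j i => hY0 i j) c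
    (fun j => q j + (∑ i, X i j - ∑ i, Y i j)) hc
    (fun j => add_nonneg (hq j) (sub_nonneg.2 (hYXc j)))
  have hF : ∑ j, |(∑ i, Y i j) + (q j + (∑ i, X i j - ∑ i, Y i j)) - c j| =
      ∑ j, |(∑ i, X i j) + q j - c j| :=
    Finset.sum_congr rfl fun j _ => by congr 1; ring
  rw [hF, Finset.sum_comm (f := fun j i => Y i j), Finset.sum_comm (f := Z)] at hZd
  simp_rw [abs_of_nonneg (hr _), abs_of_nonneg (hc _)] at hs
  obtain ⟨W, hW0, hWr, hWc, hWs, hWd⟩ := exists_sum_eq_of_row_col_le (fun i j => Z j i)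
    (fun i j => hZ0 j i) r c (fun i => (Finset.sum_le_sum fun j _ => hZY j i).trans (hYr i)) hZc s
    hs0 (hs.trans (min_le_left _ _)) (hs.trans (min_le_right _ _))
  refine ⟨W, fun i => r i - ∑ j, W i j, fun j => c j - ∑ i, W i j, hW0,
    fun i => sub_nonneg.2 (hWr i), fun j => sub_nonneg.2 (hWc j), fun i => by ring,
    fun j => by ring, hWs, ?_⟩
  have hpb := sum_abs_slack_sub_le X W r p
  have hqb := sum_abs_slack_sub_le (fun j i => X i j) (fun j i => W i j) c q
  rw [Finset.sum_comm (f := fun j i => |X i j - W i j|)] at hqb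
  have hXZ : ∑ i, ∑ j, |X i j - Z j i| = ∑ i, ∑ j, X i j - ∑ i, ∑ j, Z j i := by
    simp_rw [fun i j => abs_of_nonneg (sub_nonneg.2 ((hZY j i).trans (hYX i j))),
      Finset.sum_sub_distrib]
  have hXW : ∑ i, ∑ j, |X i j - W i j| ≤
      ∑ i, ∑ j, |X i j - Z j i| + ∑ i, ∑ j, |Z j i - W i j| := by
    simp_rw [← Finset.sum_add_distrib]
    exact Finset.sum_le_sum fun i _ => Finset.sum_le_sum fun j _ => abs_sub_le _ _ _
  have hZX : |∑ i, ∑ j, Z j i - s| ≤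
      (∑ i, ∑ j, X i j - ∑ i, ∑ j, Z j i) + |∑ i, ∑ j, X i j - s| := by
    have h := abs_sub_le (∑ i, ∑ j, Z j i) (∑ i, ∑ j, X i j) s
    rwa [abs_sub_comm (∑ i, ∑ j, Z j i) (∑ i, ∑ j, X i j), abs_of_nonneg (a := ∑ i, ∑ j, X i j - ∑ i, ∑ j, Z j i)
      (hXZ ▸ Finset.sum_nonneg fun i _ => Finset.sum_nonneg fun j _ => abs_nonneg _)] at h
  have hG := abs_nonneg (∑ i, ∑ j, X i j - s)
  linarith
end

section
/- Let n ≥ 1, let r, p, v ∈ ℝ^n have nonnegative entries, and let 0 ≤ s ≤ ‖r‖₁. Then there exists p̄ ∈ ℝ^n with 0 ≤ p̄ᵢ ≤ rᵢ for all i, ‖p̄‖₁ = ‖r‖₁ − s, and ‖p̄ − p‖₁ ≤ 3·|‖p‖₁ − ‖r‖₁ + s| + 4·‖v + p − r‖₁. -/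
/-- Between two ordered vectors there is a vector with any prescribed intermediate sum. -/
theorem exists_between_sum_eq {ι : Type*} [Fintype ι] {a b : ι → ℝ} (hab : ∀ i, a i ≤ b i)
    {T : ℝ} (ha : ∑ i, a i ≤ T) (hb : T ≤ ∑ i, b i) :
    ∃ c : ι → ℝ, (∀ i, a i ≤ c i ∧ c i ≤ b i) ∧ ∑ i, c i = T := by
  obtain ⟨t, ht0, ht1, ht⟩ : ∃ t : ℝ, 0 ≤ t ∧ t ≤ 1 ∧
      t * (∑ i, b i - ∑ i, a i) = T - ∑ i, a i := by
    rcases (ha.trans hb).eq_or_lt with h | h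
    · exact ⟨0, le_rfl, zero_le_one, by linarith⟩
    · have hpos := sub_pos.2 h
      exact ⟨(T - ∑ i, a i) / (∑ i, b i - ∑ i, a i), div_nonneg (by linarith) hpos.le,
        (div_le_one hpos).2 (by linarith), div_mul_cancel₀ _ hpos.ne'⟩
  refine ⟨fun i => a i + t * (b i - a i), fun i => ⟨?_, ?_⟩, ?_⟩
  · nlinarith [mul_nonneg ht0 (sub_nonneg.2 (hab i))]
  · nlinarith [mul_nonneg (sub_nonneg.2 ht1) (sub_nonneg.2 (hab i))]
  · rw [Finset.sum_add_distrib, ← Finset.mul_sum, Finset.sum_sub_distrib, ht]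
    ring

/-- A vector `q` in the box `[0, r]` can be moved inside the box to any attainable sum `T`,
at `ℓ1` cost `|T - ∑ i, q i|`. -/
theorem exists_mem_box_sum_eq {ι : Type*} [Fintype ι] {q r : ι → ℝ} (hq : ∀ i, 0 ≤ q i)
    (hqr : ∀ i, q i ≤ r i) {T : ℝ} (hT0 : 0 ≤ T) (hT : T ≤ ∑ i, r i) :
    ∃ c : ι → ℝ, (∀ i, 0 ≤ c i ∧ c i ≤ r i) ∧ ∑ i, c i = T ∧
      ∑ i, |c i - q i| = |T - ∑ i, q i| := by
  rcases le_total (∑ i, q i) T with h | h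
  · obtain ⟨c, hc, hsum⟩ := exists_between_sum_eq hqr h hT
    refine ⟨c, fun i => ⟨(hq i).trans (hc i).1, (hc i).2⟩, hsum, ?_⟩
    rw [abs_of_nonneg (sub_nonneg.2 h), ← hsum, ← Finset.sum_sub_distrib]
    exact Finset.sum_congr rfl fun i _ => abs_of_nonneg (sub_nonneg.2 (hc i).1)
  · obtain ⟨c, hc, hsum⟩ := exists_between_sum_eq (a := fun _ => 0) hq (by simpa using hT0) h
    refine ⟨c, fun i => ⟨(hc i).1, (hc i).2.trans (hqr i)⟩, hsum, ?_⟩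
    rw [abs_sub_comm, abs_of_nonneg (sub_nonneg.2 h), ← hsum, ← Finset.sum_sub_distrib]
    refine Finset.sum_congr rfl fun i _ => ?_
    rw [abs_sub_comm, abs_of_nonneg (sub_nonneg.2 (hc i).2)]

/-- Guarantee of the Enforcing Procedure (EP) subroutine of Round-POT, together
with the ℓ1 distance bound from the proof of the Round-POT guarantee. -/
theorem stmt_1 (n : ℕ) (hn : 1 ≤ n)
    (r p v : Fin n → ℝ) (hr : ∀ i, 0 ≤ r i) (hp : ∀ i, 0 ≤ p i) (hv : ∀ i, 0 ≤ v i)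
    (s : ℝ) (hs0 : 0 ≤ s) (hs : s ≤ ∑ i, |r i|) :
    ∃ pb : Fin n → ℝ,
      (∀ i, 0 ≤ pb i ∧ pb i ≤ r i) ∧
      (∑ i, |pb i|) = (∑ i, |r i|) - s ∧
      (∑ i, |pb i - p i|) ≤ 3 * |(∑ i, |p i|) - (∑ i, |r i|) + s|
        + 4 * (∑ i, |v i + p i - r i|) := by
  simp only [abs_of_nonneg (hr _), abs_of_nonneg (hp _)] at hs ⊢
  obtain ⟨c, hc, hsum, hdist⟩ := exists_mem_box_sum_eq (q := fun i => min (p i) (r i))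
    (fun i => le_min (hp i) (hr i)) (fun i => min_le_right _ _)
    (sub_nonneg.2 hs) (sub_le_self _ hs0)
  refine ⟨c, hc, by simpa only [abs_of_nonneg (hc _).1] using hsum, ?_⟩
  have hclip : ∑ i, p i - ∑ i, min (p i) (r i) ≤ ∑ i, |v i + p i - r i| := by
    rw [← Finset.sum_sub_distrib]
    refine Finset.sum_le_sum fun i _ => ?_
    rcases min_cases (p i) (r i) with h | h
    · rw [h.1, sub_self]
      exact abs_nonneg _
    · linarith [le_abs_self (v i + p i - r i), hv i]
  have hle : ∑ i, min (p i) (r i) ≤ ∑ i, p i :=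
    Finset.sum_le_sum fun i _ => min_le_left _ _
  have htri : ∑ i, |c i - p i| ≤
      ∑ i, |c i - min (p i) (r i)| + (∑ i, p i - ∑ i, min (p i) (r i)) := by
    rw [← Finset.sum_sub_distrib, ← Finset.sum_add_distrib]
    refine Finset.sum_le_sum fun i _ => ?_
    have h := abs_sub_le (c i) (min (p i) (r i)) (p i)
    rwa [abs_sub_comm (min (p i) (r i)) (p i),
      abs_of_nonneg (sub_nonneg.2 (min_le_left (p i) (r i)))] at h
  have hgap : |∑ i, r i - s - ∑ i, min (p i) (r i)| ≤
      |∑ i, p i - ∑ i, r i + s| + (∑ i, p i - ∑ i, min (p i) (r i)) := by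
    rw [abs_le]
    constructor <;>
      linarith [neg_abs_le (∑ i, p i - ∑ i, r i + s), le_abs_self (∑ i, p i - ∑ i, r i + s)]
  linarith [abs_nonneg (∑ i, p i - ∑ i, r i + s)]
end

section
/- Let n ≥ 1, let X ∈ ℝ^{n×n} have nonnegative entries, and let a, b ∈ ℝ^n have nonnegative entries with ‖a‖₁ = ‖b‖₁, (X𝟙)ᵢ ≤ aᵢ for all i, (Xᵀ𝟙)ⱼ ≤ bⱼ for all j, and ‖a − X𝟙‖₁ > 0. Set e₁ = a − X𝟙, e₂ = b − Xᵀ𝟙 and X̄ = X + e₁e₂ᵀ/‖e₁‖₁. Then X̄ has nonnegative entries, X̄𝟙 = a, X̄ᵀ𝟙 = b, and Σ_{i,j} X̄_{ij} = ‖a‖₁. -/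
/-- Final correction step of Round-POT: adding the rank-one correction
e₁e₂ᵀ/‖e₁‖₁ restores the exact marginals a and b. -/
theorem stmt_3 (n : ℕ) (hn : 1 ≤ n)
    (X : Matrix (Fin n) (Fin n) ℝ) (hX : ∀ i j, 0 ≤ X i j)
    (a b : Fin n → ℝ) (ha : ∀ i, 0 ≤ a i) (hb : ∀ j, 0 ≤ b j)
    (hab : (∑ i, |a i|) = ∑ j, |b j|)
    (hrow : ∀ i, (∑ j, X i j) ≤ a i) (hcol : ∀ j, (∑ i, X i j) ≤ b j)
    (hpos : 0 < ∑ i, |a i - ∑ j, X i j|) :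
    let e₁ : Fin n → ℝ := fun i => a i - ∑ j, X i j
    let e₂ : Fin n → ℝ := fun j => b j - ∑ i, X i j
    let Xb : Matrix (Fin n) (Fin n) ℝ := fun i j => X i j + e₁ i * e₂ j / (∑ i, |e₁ i|)
    (∀ i j, 0 ≤ Xb i j) ∧ (∀ i, (∑ j, Xb i j) = a i) ∧ (∀ j, (∑ i, Xb i j) = b j) ∧
      (∑ i, ∑ j, Xb i j) = ∑ i, |a i| := by
  intro e₁ e₂ Xb
  have he₁ : ∀ i, 0 ≤ e₁ i := fun i => sub_nonneg.2 (hrow i)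
  have he₂ : ∀ j, 0 ≤ e₂ j := fun j => sub_nonneg.2 (hcol j)
  have habs : ∑ i, |e₁ i| = ∑ i, e₁ i :=
    Finset.sum_congr rfl fun i _ => abs_of_nonneg (he₁ i)
  have haabs : ∑ i, |a i| = ∑ i, a i :=
    Finset.sum_congr rfl fun i _ => abs_of_nonneg (ha i)
  have hbabs : ∑ j, |b j| = ∑ j, b j :=
    Finset.sum_congr rfl fun j _ => abs_of_nonneg (hb j)
  have hmass : ∑ j, e₂ j = ∑ i, |e₁ i| := by
    rw [habs]
    simp only [e₁, e₂, Finset.sum_sub_distrib]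
    rw [← haabs, ← hbabs, hab, Finset.sum_comm]
  have hne : ∑ i, |e₁ i| ≠ 0 := hpos.ne'
  have hrows : ∀ i, ∑ j, Xb i j = a i := by
    intro i
    simp only [Xb]
    rw [Finset.sum_add_distrib, ← Finset.sum_div, ← Finset.mul_sum, hmass,
      mul_div_cancel_right₀ _ hne]
    exact add_sub_cancel _ _
  have hcols : ∀ j, ∑ i, Xb i j = b j := by
    intro j
    simp only [Xb]
    rw [Finset.sum_add_distrib, ← Finset.sum_div, ← Finset.sum_mul, ← habs,
      mul_div_cancel_left₀ _ hne]
    exact add_sub_cancel _ _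
  refine ⟨fun i j => ?_, hrows, hcols, ?_⟩
  · exact add_nonneg (hX i j) (div_nonneg (mul_nonneg (he₁ i) (he₂ j)) hpos.le)
  · rw [haabs]
    exact Finset.sum_congr rfl fun i _ => hrows i
end

section
/- Let k ≥ 1, γ > 0, D > 0 and d ∈ ℝ^k, and define f(x) = Σᵢ (γ xᵢ log xᵢ + dᵢ xᵢ). Then for all x, y ∈ ℝ^k with xᵢ > 0 and yᵢ > 0 for all i, ‖x‖₁ ≤ D and ‖y‖₁ ≤ D: f(x) ≥ f(y) + Σᵢ (γ log yᵢ + γ + dᵢ)(xᵢ − yᵢ) + (γ/(2D))·‖x − y‖₁². In other words, f is (γ/D)-strongly convex with respect to the ℓ1 norm on Q = {x ∈ ℝ^k : x > 0, ‖x‖₁ ≤ D}. -/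
open Set in
/-- The Padé-type lower bound for the logarithm with equality at `t = 1`. -/
lemma Real.sub_one_mul_div_le_log {t : ℝ} (ht : 0 < t) :
    (t - 1) * (5 * t + 1) / (2 * t * (t + 2)) ≤ Real.log t := by
  let h : ℝ → ℝ := fun t => Real.log t - (t - 1) * (5 * t + 1) / (2 * t * (t + 2))
  have hderiv : ∀ s : ℝ, 0 < s → HasDerivAt h ((s - 1) ^ 3 / (s ^ 2 * (s + 2) ^ 2)) s := by
    intro s hs
    have hnum : HasDerivAt (fun t : ℝ => (t - 1) * (5 * t + 1))
        (1 * (5 * s + 1) + (s - 1) * (5 * 1)) s :=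
      ((hasDerivAt_id s).sub_const 1).mul (((hasDerivAt_id s).const_mul 5).add_const 1)
    have hden : HasDerivAt (fun t : ℝ => 2 * t * (t + 2))
        (2 * 1 * (s + 2) + 2 * s * 1) s :=
      ((hasDerivAt_id s).const_mul 2).mul ((hasDerivAt_id s).add_const 2)
    refine ((Real.hasDerivAt_log hs.ne').sub (hnum.div hden (by positivity))).congr_deriv ?_
    field_simp
    ring
  have hcont : ∀ S : Set ℝ, S ⊆ Ioi 0 → ContinuousOn h S := fun S hS s hs =>
    (hderiv s (hS hs)).continuousAt.continuousWithinAt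
  have h_one : h 1 = 0 := by simp [h]
  suffices h 1 ≤ h t by simpa [h_one, h] using this
  rcases le_total t 1 with ht1 | ht1
  · have hanti : AntitoneOn h (Ioc 0 1) := by
      refine antitoneOn_of_deriv_nonpos (convex_Ioc 0 1) (hcont _ fun s hs => hs.1) ?_ ?_ <;>
        rw [interior_Ioc] <;> intro s hs
      · exact (hderiv s hs.1).differentiableAt.differentiableWithinAt
      · rw [(hderiv s hs.1).deriv]
        refine div_nonpos_of_nonpos_of_nonneg ?_ (by positivity)
        exact Odd.pow_nonpos (by decide) (by linarith [hs.2])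
    exact hanti ⟨ht, ht1⟩ ⟨one_pos, le_rfl⟩ ht1
  · have hmono : MonotoneOn h (Ici 1) := by
      refine monotoneOn_of_deriv_nonneg (convex_Ici 1)
        (hcont _ fun s hs => (one_pos.trans_le hs : (0 : ℝ) < s)) ?_ ?_ <;>
        rw [interior_Ici] <;> intro s hs
      · exact (hderiv s (one_pos.trans hs)).differentiableAt.differentiableWithinAt
      · rw [(hderiv s (one_pos.trans hs)).deriv]
        exact div_nonneg (pow_nonneg (sub_nonneg.2 (le_of_lt hs)) 3) (by positivity)
    exact hmono self_mem_Ici ht1 ht1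

/-- A quadratic lower bound for the Bregman divergence of `x ↦ x log x`. -/
lemma Real.sq_sub_div_le_mul_log_sub {a b : ℝ} (ha : 0 < a) (hb : 0 < b) :
    3 / 2 * (|a - b| ^ 2 / (a + 2 * b)) ≤ a * Real.log a - a * Real.log b - a + b := by
  have hlog := mul_le_mul_of_nonneg_left
    (Real.sub_one_mul_div_le_log (div_pos ha hb)) ha.le
  rw [Real.log_div ha.ne' hb.ne'] at hlog
  have hrat : 3 / 2 * ((a - b) ^ 2 / (a + 2 * b)) =
      a * ((a / b - 1) * (5 * (a / b) + 1) / (2 * (a / b) * (a / b + 2))) - a + b := by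
    field_simp
    ring
  rw [sq_abs, hrat]
  linarith

/-- A Pinsker inequality for positive vectors of total mass at most `D`. -/
lemma sq_sum_abs_sub_le_sum_mul_log_sub {ι : Type*} [Fintype ι] {D : ℝ} (hD : 0 < D)
    {x y : ι → ℝ} (hx : ∀ i, 0 < x i) (hy : ∀ i, 0 < y i)
    (hxD : ∑ i, x i ≤ D) (hyD : ∑ i, y i ≤ D) :
    1 / (2 * D) * (∑ i, |x i - y i|) ^ 2 ≤
      ∑ i, (x i * Real.log (x i) - x i * Real.log (y i) - x i + y i) := by
  have hpos : ∀ i, 0 < x i + 2 * y i := fun i => by linarith [hx i, hy i]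
  have hmass : ∑ i, (x i + 2 * y i) ≤ 3 * D := by
    rw [Finset.sum_add_distrib, ← Finset.mul_sum]
    linarith
  have hsum : (∑ i, |x i - y i|) ^ 2 ≤
      3 * D * ∑ i, |x i - y i| ^ 2 / (x i + 2 * y i) := by
    refine (Finset.sum_sq_le_sum_mul_sum_of_sq_le_mul Finset.univ
      (f := fun i => x i + 2 * y i) (g := fun i => |x i - y i| ^ 2 / (x i + 2 * y i))
      (fun i _ => (hpos i).le) (fun i _ => div_nonneg (sq_nonneg _) (hpos i).le)
      (fun i _ => (mul_div_cancel₀ _ (hpos i).ne').ge)).trans ?_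
    exact mul_le_mul_of_nonneg_right hmass
      (Finset.sum_nonneg fun i _ => div_nonneg (sq_nonneg _) (hpos i).le)
  calc 1 / (2 * D) * (∑ i, |x i - y i|) ^ 2
      ≤ 1 / (2 * D) * (3 * D * ∑ i, |x i - y i| ^ 2 / (x i + 2 * y i)) := by gcongr
    _ = ∑ i, 3 / 2 * (|x i - y i| ^ 2 / (x i + 2 * y i)) := by
        rw [← Finset.mul_sum]
        field_simp
    _ ≤ _ := Finset.sum_le_sum fun i _ => Real.sq_sub_div_le_mul_log_sub (hx i) (hy i)

/-- The entropic-regularized objective f(x) = Σᵢ (γ xᵢ log xᵢ + dᵢ xᵢ) is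
(γ/D)-strongly convex with respect to the ℓ1 norm on
Q = {x : x > 0, ‖x‖₁ ≤ D}. -/
theorem stmt_7 (k : ℕ) (hk : 1 ≤ k) (γ D : ℝ) (hγ : 0 < γ) (hD : 0 < D)
    (d : Fin k → ℝ) (x y : Fin k → ℝ)
    (hx : ∀ i, 0 < x i) (hy : ∀ i, 0 < y i)
    (hxD : (∑ i, |x i|) ≤ D) (hyD : (∑ i, |y i|) ≤ D) :
    (∑ i, (γ * (x i * Real.log (x i)) + d i * x i))
      ≥ (∑ i, (γ * (y i * Real.log (y i)) + d i * y i))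
        + (∑ i, (γ * Real.log (y i) + γ + d i) * (x i - y i))
        + (γ / (2 * D)) * (∑ i, |x i - y i|) ^ 2 := by
  simp only [abs_of_pos (hx _)] at hxD
  simp only [abs_of_pos (hy _)] at hyD
  have hpinsker := mul_le_mul_of_nonneg_left
    (sq_sum_abs_sub_le_sum_mul_log_sub hD hx hy hxD hyD) hγ.le
  have hbregman : ∑ i, (γ * (x i * Real.log (x i)) + d i * x i) =
      ∑ i, (γ * (y i * Real.log (y i)) + d i * y i)
        + ∑ i, (γ * Real.log (y i) + γ + d i) * (x i - y i)
        + γ * ∑ i, (x i * Real.log (x i) - x i * Real.log (y i) - x i + y i) := by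
    rw [Finset.mul_sum, ← Finset.sum_add_distrib, ← Finset.sum_add_distrib]
    exact Finset.sum_congr rfl fun i _ => by ring
  rw [ge_iff_le, hbregman, ← mul_one_div γ (2 * D), mul_assoc γ]
  exact add_le_add_right hpinsker _
end

section
/- Let k ≥ 1, D > 0, and let x, y ∈ ℝ^k satisfy xᵢ > 0 and yᵢ > 0 for all i, Σᵢ xᵢ ≤ D and Σᵢ yᵢ ≤ D. Then Σᵢ (xᵢ − yᵢ)(log xᵢ − log yᵢ) ≥ (1/D)·(Σᵢ |xᵢ − yᵢ|)². -/
/-- For `0 < b ≤ a`, the logarithmic mean of `a` and `b` is at most their arithmetic mean. -/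
lemma two_mul_sub_div_add_le_log_sub_log {a b : ℝ} (hb : 0 < b) (hab : b ≤ a) :
    2 * (a - b) / (a + b) ≤ Real.log a - Real.log b := by
  have ha : 0 < a := hb.trans_le hab
  have h := Real.le_log_one_add_of_nonneg (div_nonneg (sub_nonneg.2 hab) hb.le)
  have h₁ : 1 + (a - b) / b = a / b := by field_simp; ring
  have h₂ : 2 * ((a - b) / b) / ((a - b) / b + 2) = 2 * (a - b) / (a + b) := by
    have h₃ : (a - b) / b + 2 = (a + b) / b := by field_simp; ring
    rw [h₃]
    field_simp
  rwa [h₁, h₂, Real.log_div ha.ne' hb.ne'] at h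

lemma sq_abs_sub_div_le_sub_mul_log_sub_log {a b : ℝ} (ha : 0 < a) (hb : 0 < b) :
    |a - b| ^ 2 / ((a + b) / 2) ≤ (a - b) * (Real.log a - Real.log b) := by
  wlog hab : b ≤ a generalizing a b
  · have h := this hb ha (le_of_not_ge hab)
    rw [abs_sub_comm, add_comm a b]
    linarith
  · have h := mul_le_mul_of_nonneg_left (two_mul_sub_div_add_le_log_sub_log hb hab)
      (sub_nonneg.2 hab)
    refine le_of_eq_of_le ?_ h
    rw [sq_abs]
    field_simp

/-- Strong monotonicity of the gradient of the negative entropy in ℓ1 norm on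
positive vectors of total mass at most D. -/
theorem stmt_8 (k : ℕ) (hk : 1 ≤ k) (D : ℝ) (hD : 0 < D)
    (x y : Fin k → ℝ) (hx : ∀ i, 0 < x i) (hy : ∀ i, 0 < y i)
    (hxD : (∑ i, x i) ≤ D) (hyD : (∑ i, y i) ≤ D) :
    (∑ i, (x i - y i) * (Real.log (x i) - Real.log (y i)))
      ≥ (1 / D) * (∑ i, |x i - y i|) ^ 2 := by
  have hpos : ∀ i, 0 < (x i + y i) / 2 := fun i => half_pos (add_pos (hx i) (hy i))
  have hmass : ∑ i, (x i + y i) / 2 ≤ D := by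
    rw [← Finset.sum_div, Finset.sum_add_distrib]
    linarith
  have hmass_pos : 0 < ∑ i, (x i + y i) / 2 :=
    Finset.sum_pos (fun i _ => hpos i) ⟨⟨0, hk⟩, Finset.mem_univ _⟩
  calc (1 / D) * (∑ i, |x i - y i|) ^ 2
      = (∑ i, |x i - y i|) ^ 2 / D := by ring
    _ ≤ (∑ i, |x i - y i|) ^ 2 / ∑ i, (x i + y i) / 2 := by gcongr
    _ ≤ ∑ i, |x i - y i| ^ 2 / ((x i + y i) / 2) :=
        Finset.sq_sum_div_le_sum_sq_div _ _ fun i _ => hpos i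
    _ ≤ ∑ i, (x i - y i) * (Real.log (x i) - Real.log (y i)) :=
        Finset.sum_le_sum fun i _ => sq_abs_sub_div_le_sub_mul_log_sub_log (hx i) (hy i)
end

section
/- Let n ≥ 1, γ > 0, let C ∈ ℝ^{n×n} have nonnegative entries, let r, c ∈ ℝ^n have nonnegative entries, and let 0 ≤ s < m* where m* = min{‖r‖₁, ‖c‖₁}. Suppose u, v ∈ ℝ^n with uᵢ ≤ 0 and vⱼ ≤ 0 for all i, j and w ∈ ℝ satisfy: (i) uᵢ + vⱼ + w ≤ C_{ij}/γ for all i, j, and (ii) ⟨u, r⟩ + ⟨v, c⟩ + w·s ≥ 0. Then w ≤ ‖C‖_max · m* / (γ·(m* − s)), where ‖C‖_max = max_{i,j} C_{ij}. -/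
/-- A weighted sum with nonnegative weights of nonpositive numbers bounded by `a ≤ 0` is at most
`a * m`, for every lower bound `m` of the total weight. -/
theorem sum_mul_le_mul_of_le_sum_abs {ι : Type*} [Fintype ι] {x y : ι → ℝ} {a m : ℝ}
    (hx : ∀ i, x i ≤ a) (ha : a ≤ 0) (hy : ∀ i, 0 ≤ y i) (hm : m ≤ ∑ i, |y i|) :
    ∑ i, x i * y i ≤ a * m := by
  calc ∑ i, x i * y i ≤ ∑ i, a * |y i| := Finset.sum_le_sum fun i _ => by
        rw [abs_of_nonneg (hy i)]
        exact mul_le_mul_of_nonneg_right (hx i) (hy i)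
    _ = a * ∑ i, |y i| := (Finset.mul_sum ..).symm
    _ ≤ a * m := mul_le_mul_of_nonpos_left hm ha

/-- Upper bound on the third dual variable w of entropic POT:
w ≤ ‖C‖_max · m* / (γ (m* − s)) where m* = min{‖r‖₁, ‖c‖₁} and
Cmax = ‖C‖_max = max_{i,j} C_{ij}. -/
theorem stmt_12 (n : ℕ) (hn : 1 ≤ n) (γ : ℝ) (hγ : 0 < γ)
    (C : Matrix (Fin n) (Fin n) ℝ) (hC : ∀ i j, 0 ≤ C i j)
    (Cmax : ℝ) (hCmax : IsGreatest {v : ℝ | ∃ i j, v = C i j} Cmax)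
    (r c : Fin n → ℝ) (hr : ∀ i, 0 ≤ r i) (hc : ∀ j, 0 ≤ c j)
    (s : ℝ) (hs0 : 0 ≤ s) (hs : s < min (∑ i, |r i|) (∑ j, |c j|))
    (u v : Fin n → ℝ) (hu : ∀ i, u i ≤ 0) (hv : ∀ j, v j ≤ 0) (w : ℝ)
    (h1 : ∀ i j, u i + v j + w ≤ C i j / γ)
    (h2 : (∑ i, u i * r i) + (∑ j, v j * c j) + w * s ≥ 0) :
    w ≤ Cmax * min (∑ i, |r i|) (∑ j, |c j|)
        / (γ * (min (∑ i, |r i|) (∑ j, |c j|) - s)) := by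
  have : Nonempty (Fin n) := ⟨⟨0, hn⟩⟩
  obtain ⟨i, hi⟩ := Finite.exists_max u
  obtain ⟨j, hj⟩ := Finite.exists_max v
  have hur := sum_mul_le_mul_of_le_sum_abs hi (hu i) hr (min_le_left _ (∑ j, |c j|))
  have hvc := sum_mul_le_mul_of_le_sum_abs hj (hv j) hc (min_le_right (∑ i, |r i|) _)
  set m := min (∑ i, |r i|) (∑ j, |c j|)
  have hm : 0 < m - s := sub_pos.2 hs
  have hK : u i + v j + w ≤ Cmax / γ :=
    (h1 i j).trans (div_le_div_of_nonneg_right (hCmax.2 ⟨i, j, rfl⟩) hγ.le)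
  have hKm := mul_le_mul_of_nonneg_right hK (hs0.trans hs.le)
  rw [← div_div, mul_div_right_comm, le_div_iff₀ hm]
  linarith
end

section
/- Let k, l ≥ 1, A ∈ ℝ^{l×k}, b ∈ ℝ^l and d ∈ ℝ^k, and let Δ_k be the probability simplex in ℝ^k. Assume: (i) there exists x ∈ Δ_k with Ax = b; and (ii) for every x ∈ Δ_k there exists x̄ ∈ Δ_k with Ax̄ = b and ‖x − x̄‖₁ ≤ 23·‖Ax − b‖₁. Then inf_{x ∈ Δ_k} (⟨d, x⟩ + 23‖d‖_∞ ‖Ax − b‖₁) = inf_{x ∈ Δ_k, Ax = b} ⟨d, x⟩. -/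
/-- Hölder's inequality between the sup norm and the ℓ1 norm on `ι → ℝ`. -/
lemma abs_sum_mul_le_norm_mul_sum_abs {ι : Type*} [Fintype ι] (d y : ι → ℝ) :
    |∑ i, d i * y i| ≤ ‖d‖ * ∑ i, |y i| := by
  rw [Finset.mul_sum]
  refine (Finset.abs_sum_le_sum_abs _ _).trans (Finset.sum_le_sum fun i _ => ?_)
  rw [abs_mul]
  exact mul_le_mul_of_nonneg_right (norm_le_pi_norm d i) (abs_nonneg _)

/-- A linear functional on the simplex is bounded below by minus its sup norm. -/
lemma neg_norm_le_sum_mul_of_mem_stdSimplex {ι : Type*} [Fintype ι] (d : ι → ℝ) {x : ι → ℝ}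
    (hx : x ∈ stdSimplex ℝ ι) : -‖d‖ ≤ ∑ i, d i * x i := by
  have h := abs_sum_mul_le_norm_mul_sum_abs d x
  rw [Finset.sum_congr rfl fun i _ => abs_of_nonneg (hx.1 i), hx.2, mul_one] at h
  exact (abs_le.mp h).1

/-- First claim of the ℓ1-penalization lemma: given feasibility and the
Round-POT rounding guarantee, the ℓ1-penalized objective over the simplex has
the same infimum as the constrained problem.  Here ‖d‖ is the sup norm of
d : Fin k → ℝ. -/
theorem stmt_14 (k l : ℕ) (hk : 1 ≤ k) (hl : 1 ≤ l)
    (A : Matrix (Fin l) (Fin k) ℝ) (b : Fin l → ℝ) (d : Fin k → ℝ)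
    (hfeas : ∃ x ∈ stdSimplex ℝ (Fin k), A.mulVec x = b)
    (hround : ∀ x ∈ stdSimplex ℝ (Fin k), ∃ xb ∈ stdSimplex ℝ (Fin k),
      A.mulVec xb = b ∧ (∑ i, |x i - xb i|) ≤ 23 * ∑ i, |A.mulVec x i - b i|) :
    sInf {w : ℝ | ∃ x ∈ stdSimplex ℝ (Fin k),
        w = (∑ i, d i * x i) + 23 * ‖d‖ * ∑ i, |A.mulVec x i - b i|}
      = sInf {w : ℝ | ∃ x ∈ stdSimplex ℝ (Fin k),
          A.mulVec x = b ∧ w = ∑ i, d i * x i} := by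
  obtain ⟨x₀, hx₀, hAx₀⟩ := hfeas
  apply le_antisymm
  · refine csInf_le_csInf ⟨-‖d‖, ?_⟩ ⟨_, x₀, hx₀, hAx₀, rfl⟩ ?_
    · rintro w ⟨x, hx, rfl⟩
      exact (neg_norm_le_sum_mul_of_mem_stdSimplex d hx).trans
        (le_add_of_nonneg_right (by positivity))
    · rintro w ⟨x, hx, hAx, rfl⟩
      exact ⟨x, hx, by simp [hAx]⟩
  · refine le_csInf ⟨_, x₀, hx₀, rfl⟩ ?_
    rintro w ⟨x, hx, rfl⟩
    obtain ⟨y, hy, hAy, hxy⟩ := hround x hx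
    have hle : sInf {w : ℝ | ∃ x ∈ stdSimplex ℝ (Fin k),
        A.mulVec x = b ∧ w = ∑ i, d i * x i} ≤ ∑ i, d i * y i := by
      refine csInf_le ⟨-‖d‖, ?_⟩ ⟨y, hy, hAy, rfl⟩
      rintro w ⟨z, hz, -, rfl⟩
      exact neg_norm_le_sum_mul_of_mem_stdSimplex d hz
    have hdiff := (abs_le.mp (abs_sum_mul_le_norm_mul_sum_abs d fun i => x i - y i)).1
    simp only [mul_sub, Finset.sum_sub_distrib] at hdiff
    have hpen := mul_le_mul_of_nonneg_left hxy (norm_nonneg d)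
    linarith
end

section
/- Let k, m ≥ 1 and let A ∈ ℝ^{k×m} have nonnegative entries with Σᵢ A_{ij} ≤ 3 for every column j. Let x ∈ ℝ^m with xⱼ > 0 for all j and y ∈ ℝ^k with |yᵢ| ≤ 1 for all i. Then for all a, c ∈ ℝ^m and b, d ∈ ℝ^k: 30 Σⱼ aⱼ²/xⱼ + 30 Σⱼ cⱼ²/xⱼ + 6 Σ_{i,j} A_{ij}(bᵢ² + dᵢ²) xⱼ + 12 Σ_{i,j} A_{ij} aⱼ bᵢ yᵢ + 12 Σ_{i,j} A_{ij} cⱼ dᵢ yᵢ − 2 Σ_{i,j} A_{ij} aⱼ dᵢ + 2 Σ_{i,j} A_{ij} cⱼ bᵢ ≥ 0. -/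
/-- The two-by-two-variable quadratic form attached to a single matrix entry is nonnegative. -/
lemma entry_form_nonneg {x y : ℝ} (hx : 0 < x) (hy : |y| ≤ 1) (a b c d : ℝ) :
    0 ≤ 10 * (a ^ 2 / x) + 10 * (c ^ 2 / x) + 6 * ((b ^ 2 + d ^ 2) * x)
      + 12 * (a * b * y) + 12 * (c * d * y) - 2 * (a * d) + 2 * (c * b) := by
  have hy2 : y ^ 2 ≤ 1 := (sq_le_one_iff_abs_le_one y).2 hy
  have key : 10 * (a ^ 2 / x) + 10 * (c ^ 2 / x) + 6 * ((b ^ 2 + d ^ 2) * x)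
      + 12 * (a * b * y) + 12 * (c * d * y) - 2 * (a * d) + 2 * (c * b)
      = ((6 * b * x + 6 * a * y + c) ^ 2 + (6 * d * x + 6 * c * y - a) ^ 2
        + (59 - 36 * y ^ 2) * (a ^ 2 + c ^ 2)) / (6 * x) := by
    field_simp
    ring
  rw [key]
  have : 0 ≤ 59 - 36 * y ^ 2 := by linarith
  positivity

/-- If the column sums of `A` are at most `C`, then the `A`-weighted sum of nonnegative column
weights is at most `C` times their sum. -/
lemma sum_sum_mul_le_of_col_sum_le {ι κ : Type*} [Fintype ι] [Fintype κ] {A : Matrix ι κ ℝ}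
    {C : ℝ} (hA : ∀ j, ∑ i, A i j ≤ C) {w : κ → ℝ} (hw : ∀ j, 0 ≤ w j) :
    ∑ i, ∑ j, A i j * w j ≤ C * ∑ j, w j := by
  rw [Finset.sum_comm, Finset.mul_sum]
  refine Finset.sum_le_sum fun j _ => ?_
  rw [← Finset.sum_mul]
  exact mul_le_mul_of_nonneg_right (hA j) (hw j)


/-- Positive semidefiniteness of the block matrix in the second-order criterion
for 9-area-convexity of the Sherman regularizer for POT: the displayed quadratic
form (a,b,c,d) ξ (a,b,c,d)ᵀ is nonnegative. -/
theorem stmt_16 (k m : ℕ) (hk : 1 ≤ k) (hm : 1 ≤ m)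
    (A : Matrix (Fin k) (Fin m) ℝ) (hA : ∀ i j, 0 ≤ A i j)
    (hAcol : ∀ j, (∑ i, A i j) ≤ 3)
    (x : Fin m → ℝ) (hx : ∀ j, 0 < x j)
    (y : Fin k → ℝ) (hy : ∀ i, |y i| ≤ 1)
    (a c : Fin m → ℝ) (b d : Fin k → ℝ) :
    30 * (∑ j, a j ^ 2 / x j) + 30 * (∑ j, c j ^ 2 / x j)
      + 6 * (∑ i, ∑ j, A i j * (b i ^ 2 + d i ^ 2) * x j)
      + 12 * (∑ i, ∑ j, A i j * a j * b i * y i)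
      + 12 * (∑ i, ∑ j, A i j * c j * d i * y i)
      - 2 * (∑ i, ∑ j, A i j * a j * d i)
      + 2 * (∑ i, ∑ j, A i j * c j * b i) ≥ 0 := by
  have ha := sum_sum_mul_le_of_col_sum_le hAcol fun j => div_nonneg (sq_nonneg (a j)) (hx j).le
  have hc := sum_sum_mul_le_of_col_sum_le hAcol fun j => div_nonneg (sq_nonneg (c j)) (hx j).le
  have hsum : 0 ≤ ∑ i, ∑ j, A i j * (10 * (a j ^ 2 / x j) + 10 * (c j ^ 2 / x j)
      + 6 * ((b i ^ 2 + d i ^ 2) * x j) + 12 * (a j * b i * y i) + 12 * (c j * d i * y i)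
      - 2 * (a j * d i) + 2 * (c j * b i)) :=
    Finset.sum_nonneg fun i _ => Finset.sum_nonneg fun j _ =>
      mul_nonneg (hA i j) (entry_form_nonneg (hx j) (hy i) _ _ _ _)
  simp only [mul_add, mul_sub, mul_left_comm (A _ _) (OfNat.ofNat _), Finset.sum_add_distrib,
    Finset.sum_sub_distrib, ← Finset.mul_sum] at hsum
  simp only [mul_add, add_mul, mul_assoc, Finset.sum_add_distrib] at hsum ⊢
  linarith
end

section
/- Let n ≥ 1, γ > 0, C ∈ ℝ^{n×n}, r, c ∈ ℝ^n and s ∈ ℝ. Suppose X ∈ ℝ^{n×n} and p, q ∈ ℝ^n have nonnegative entries and satisfy X𝟙 + p = r, Xᵀ𝟙 + q = c, and Σ_{i,j} X_{ij} = s. Then for all y, z ∈ ℝ^n and t ∈ ℝ: ⟨C, X⟩ + γ·(Σ_{i,j} X_{ij} log X_{ij} + Σᵢ pᵢ log pᵢ + Σⱼ qⱼ log qⱼ) ≥ −⟨y, r⟩ − ⟨z, c⟩ − t·s − γ·Σ_{i,j} exp(−(C_{ij} + yᵢ + zⱼ + t)/γ − 1) − γ·Σᵢ exp(−yᵢ/γ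 − 1) − γ·Σⱼ exp(−zⱼ/γ − 1). -/
/-- Fenchel-Young inequality for the scaled negative entropy `γ * x * log x`. -/
theorem entropy_fenchel_young {γ : ℝ} (hγ : 0 < γ) {x : ℝ} (hx : 0 ≤ x) (a : ℝ) :
    0 ≤ a * x + γ * (x * Real.log x) + γ * Real.exp (-a / γ - 1) := by
  rcases hx.eq_or_lt with rfl | hx
  · simp only [mul_zero, zero_mul, zero_add]
    positivity
  · have hexp : x * Real.exp (-a / γ - 1 - Real.log x) = Real.exp (-a / γ - 1) := by
      rw [Real.exp_sub, Real.exp_log hx]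
      field_simp
    have hle := Real.add_one_le_exp (-a / γ - 1 - Real.log x)
    have hmul := mul_le_mul_of_nonneg_left hle (mul_pos hγ hx).le
    rw [mul_assoc γ x (Real.exp _), hexp] at hmul
    have hlhs : γ * x * (-a / γ - 1 - Real.log x + 1) = -(a * x) - γ * (x * Real.log x) := by
      field_simp
      ring
    linarith

/-- Weak duality for entropic-regularized POT: the primal objective at any
feasible (X, p, q) dominates the Lagrangian dual objective at any (y, z, t).
(Real.log 0 = 0 in Mathlib, matching the convention 0·log 0 = 0.) -/
theorem stmt_18 (n : ℕ) (hn : 1 ≤ n) (γ : ℝ) (hγ : 0 < γ)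
    (C : Matrix (Fin n) (Fin n) ℝ) (r c : Fin n → ℝ) (s : ℝ)
    (X : Matrix (Fin n) (Fin n) ℝ) (p q : Fin n → ℝ)
    (hX : ∀ i j, 0 ≤ X i j) (hp : ∀ i, 0 ≤ p i) (hq : ∀ j, 0 ≤ q j)
    (hrow : ∀ i, (∑ j, X i j) + p i = r i)
    (hcol : ∀ j, (∑ i, X i j) + q j = c j)
    (hmass : (∑ i, ∑ j, X i j) = s)
    (y z : Fin n → ℝ) (t : ℝ) :
    (∑ i, ∑ j, C i j * X i j)
      + γ * ((∑ i, ∑ j, X i j * Real.log (X i j))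
          + (∑ i, p i * Real.log (p i)) + (∑ j, q j * Real.log (q j)))
      ≥ -(∑ i, y i * r i) - (∑ j, z j * c j) - t * s
        - γ * (∑ i, ∑ j, Real.exp (-(C i j + y i + z j + t) / γ - 1))
        - γ * (∑ i, Real.exp (-(y i) / γ - 1))
        - γ * (∑ j, Real.exp (-(z j) / γ - 1)) := by
  have hXsum := Finset.sum_nonneg fun i (_ : i ∈ Finset.univ) =>
    Finset.sum_nonneg fun j (_ : j ∈ Finset.univ) =>
      entropy_fenchel_young hγ (hX i j) (C i j + y i + z j + t)
  have hpsum := Finset.sum_nonneg fun i (_ : i ∈ Finset.univ) =>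
    entropy_fenchel_young hγ (hp i) (y i)
  have hqsum := Finset.sum_nonneg fun j (_ : j ∈ Finset.univ) =>
    entropy_fenchel_young hγ (hq j) (z j)
  have hyr : ∑ i, y i * r i = (∑ i, ∑ j, y i * X i j) + ∑ i, y i * p i := by
    simp only [← hrow, mul_add, Finset.sum_add_distrib, Finset.mul_sum]
  have hzc : ∑ j, z j * c j = (∑ i, ∑ j, z j * X i j) + ∑ j, z j * q j := by
    rw [Finset.sum_comm]
    simp only [← hcol, mul_add, Finset.sum_add_distrib, Finset.mul_sum]
  simp only [add_mul, Finset.sum_add_distrib, ← Finset.mul_sum] at hXsum hpsum hqsum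
  simp only [← Finset.mul_sum] at hyr hzc
  rw [hmass] at hXsum
  linarith
end
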